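/- Let 𝓕 be a family of finite subsets of ℕ covering ℕ. Then 𝓕 is precompact if and only if for every τ : ℕ → (0,∞), whenever the 𝓕-ideal 𝓘_{𝓕,τ} is F_σ, it is a trivial modification of Fin. -/

import Mathlib

open Filter Topology ENNReal

open Classical in
/-- The characteristic function of a set of naturals, as an element of the Cantor space. -/
noncomputable def chi (A : Set ℕ) : ℕ → Bool := fun n => decide (n ∈ A)

/-- A set in the Cantor space is F_σ if it is a countable union of closed sets. -/
def IsFsigma (S : Set (ℕ → Bool)) : Prop :=
  ∃ C : ℕ → Set (ℕ → Bool), (∀ n, IsClosed (C n)) ∧ S = ⋃ n, C n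

/-- `𝓕` is precompact: every member of the closure of `𝓕` in the Cantor space is finite. -/
def Precompact (𝓕 : Set (Set ℕ)) : Prop :=
  ∀ g ∈ closure (chi '' 𝓕), {n | g n = true}.Finite

/-- `φ_{𝓕,τ}(A) = sup_{F ∈ 𝓕} Σ_{i ∈ F ∩ A} τ i`. -/
noncomputable def phiFam (𝓕 : Set (Set ℕ)) (τ : ℕ → ℝ) (A : Set ℕ) : ℝ≥0∞ :=
  ⨆ F ∈ 𝓕, ∑' i : ↥(F ∩ A), ENNReal.ofReal (τ i)

/-- The `𝓕`-ideal `𝓘_{𝓕,τ} = Exh(φ_{𝓕,τ})`. -/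
def idealFam (𝓕 : Set (Set ℕ)) (τ : ℕ → ℝ) : Set (Set ℕ) :=
  {A | Tendsto (fun n : ℕ => phiFam 𝓕 τ (A \ Set.Iio n)) atTop (𝓝 0)}

/-- The total `τ`-weight of a set of naturals. -/
noncomputable def mass (τ : ℕ → ℝ) (A : Set ℕ) : ℝ≥0∞ := ∑' i : A, ENNReal.ofReal (τ i)

section Mass

variable {τ : ℕ → ℝ} {A B : Set ℕ}

lemma mass_mono (h : A ⊆ B) : mass τ A ≤ mass τ B :=
  ENNReal.tsum_mono_subtype (fun i => ENNReal.ofReal (τ i)) h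

lemma mass_union_le : mass τ (A ∪ B) ≤ mass τ A + mass τ B :=
  ENNReal.tsum_union_le (fun i => ENNReal.ofReal (τ i)) A B

lemma mass_iUnion_le (A : ℕ → Set ℕ) : mass τ (⋃ n, A n) ≤ ∑' n, mass τ (A n) :=
  ENNReal.tsum_iUnion_le_tsum (fun i => ENNReal.ofReal (τ i)) A

@[simp] lemma mass_empty : mass τ ∅ = 0 := by simp [mass]

lemma mass_singleton (i : ℕ) : mass τ {i} = ENNReal.ofReal (τ i) := by
  rw [mass, tsum_singleton i (fun i => ENNReal.ofReal (τ i))]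

lemma mass_eq_tsum_indicator (A : Set ℕ) :
    mass τ A = ∑' i, A.indicator (fun i => ENNReal.ofReal (τ i)) i :=
  tsum_subtype A (fun i => ENNReal.ofReal (τ i))

lemma mass_eq_iSup (A : Set ℕ) :
    mass τ A = ⨆ n, ∑ i ∈ Finset.range n, A.indicator (fun i => ENNReal.ofReal (τ i)) i := by
  rw [mass_eq_tsum_indicator, ENNReal.tsum_eq_iSup_nat]

lemma mass_range {a : ℕ → ℕ} (ha : Function.Injective a) :
    mass τ (Set.range a) = ∑' k, ENNReal.ofReal (τ (a k)) :=
  tsum_range (fun i => ENNReal.ofReal (τ i)) ha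

lemma mass_Iio_ne_top (n : ℕ) : mass τ (Set.Iio n) ≠ ⊤ := by
  have h := Finset.tsum_subtype (Finset.range n) (fun i => ENNReal.ofReal (τ i))
  have h2 : mass τ (Set.Iio n) = ∑ i ∈ Finset.range n, ENNReal.ofReal (τ i) := by
    rw [← h, mass]
    exact tsum_congr_set_coe (fun i => ENNReal.ofReal (τ i)) (by ext; simp)
  rw [h2]
  exact ENNReal.sum_ne_top.2 fun _ _ => ENNReal.ofReal_ne_top

lemma tendsto_mass_diff_Iio (h : mass τ A ≠ ⊤) :
    Tendsto (fun n => mass τ (A \ Set.Iio n)) atTop (𝓝 0) := by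
  rw [mass_eq_tsum_indicator] at h
  refine (ENNReal.tendsto_sum_nat_add _ h).congr fun n => ?_
  rw [mass_eq_tsum_indicator, ← ENNReal.summable.sum_add_tsum_nat_add'
    (f := (A \ Set.Iio n).indicator fun i => ENNReal.ofReal (τ i)) (k := n),
    Finset.sum_eq_zero, zero_add]
  · refine tsum_congr fun k => ?_
    by_cases hk : k + n ∈ A <;> simp [Set.indicator, hk]
  · intro i hi
    simp [Finset.mem_range.1 hi]

end Mass

section Phi

variable {𝓕 𝓖 : Set (Set ℕ)} {τ : ℕ → ℝ} {A B : Set ℕ}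

lemma phiFam_le_iff {c : ℝ≥0∞} : phiFam 𝓕 τ A ≤ c ↔ ∀ F ∈ 𝓕, mass τ (F ∩ A) ≤ c :=
  iSup₂_le_iff

lemma mass_inter_le_phiFam {F : Set ℕ} (hF : F ∈ 𝓕) : mass τ (F ∩ A) ≤ phiFam 𝓕 τ A :=
  phiFam_le_iff.1 le_rfl F hF

lemma phiFam_mono (h : A ⊆ B) : phiFam 𝓕 τ A ≤ phiFam 𝓕 τ B :=
  phiFam_le_iff.2 fun _ hF =>
    (mass_mono (Set.inter_subset_inter_right _ h)).trans (mass_inter_le_phiFam hF)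

lemma phiFam_le_mass : phiFam 𝓕 τ A ≤ mass τ A :=
  phiFam_le_iff.2 fun _ _ => mass_mono Set.inter_subset_right

lemma phiFam_union_le : phiFam 𝓕 τ (A ∪ B) ≤ phiFam 𝓕 τ A + phiFam 𝓕 τ B := by
  refine phiFam_le_iff.2 fun F hF => ?_
  rw [Set.inter_union_distrib_left]
  exact mass_union_le.trans (add_le_add (mass_inter_le_phiFam hF) (mass_inter_le_phiFam hF))

lemma phiFam_iUnion_le (A : ℕ → Set ℕ) : phiFam 𝓕 τ (⋃ n, A n) ≤ ∑' n, phiFam 𝓕 τ (A n) := by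
  refine phiFam_le_iff.2 fun F hF => ?_
  rw [Set.inter_iUnion]
  exact (mass_iUnion_le _).trans (ENNReal.tsum_le_tsum fun n => mass_inter_le_phiFam hF)

lemma ofReal_le_phiFam (hcov : ∀ n : ℕ, ∃ F ∈ 𝓕, n ∈ F) {i : ℕ} (hi : i ∈ A) :
    ENNReal.ofReal (τ i) ≤ phiFam 𝓕 τ A := by
  obtain ⟨F, hF, hiF⟩ := hcov i
  rw [← mass_singleton]
  exact (mass_mono (by simpa using ⟨hiF, hi⟩)).trans (mass_inter_le_phiFam hF)

lemma exists_lt_phiFam_inter_Iio (hfin : ∀ F ∈ 𝓕, F.Finite) {c : ℝ≥0∞}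
    (h : c < phiFam 𝓕 τ A) : ∃ m, c < phiFam 𝓕 τ (A ∩ Set.Iio m) := by
  obtain ⟨F, hF, hc⟩ : ∃ F ∈ 𝓕, c < mass τ (F ∩ A) := by
    by_contra! h'
    exact h.not_ge (phiFam_le_iff.2 h')
  obtain ⟨m, hm⟩ := (hfin F hF).bddAbove
  refine ⟨m + 1, hc.trans_le ((mass_mono ?_).trans (mass_inter_le_phiFam hF))⟩
  exact fun i hi => ⟨hi.1, hi.2, Nat.lt_succ_of_le (hm hi.1)⟩

/-- If all weights on `A` are at most `δ` and `A` has submeasure above `c`, some initial segment of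
`A` has submeasure in `(c, c + δ]`. -/
lemma exists_phiFam_inter_Iio_mem_Ioc (hfin : ∀ F ∈ 𝓕, F.Finite) {c δ : ℝ≥0∞}
    (hδ : ∀ i ∈ A, ENNReal.ofReal (τ i) ≤ δ) (h : c < phiFam 𝓕 τ A) :
    ∃ m, c < phiFam 𝓕 τ (A ∩ Set.Iio m) ∧ phiFam 𝓕 τ (A ∩ Set.Iio m) ≤ c + δ := by
  classical
  have hex := exists_lt_phiFam_inter_Iio hfin h
  refine ⟨Nat.find hex, Nat.find_spec hex, ?_⟩
  have hmin := fun k => Nat.find_min hex (m := k)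
  generalize Nat.find hex = m at hmin
  cases m with
  | zero => simp [phiFam]
  | succ m =>
    have h1 : phiFam 𝓕 τ (A ∩ Set.Iio m) ≤ c := not_lt.1 (hmin m (Nat.lt_succ_self m))
    by_cases hm : m ∈ A
    · calc phiFam 𝓕 τ (A ∩ Set.Iio (m + 1))
          ≤ phiFam 𝓕 τ ((A ∩ Set.Iio m) ∪ {m}) := phiFam_mono fun i hi => by
            rcases Nat.lt_succ_iff_lt_or_eq.1 hi.2 with h | h
            · exact Or.inl ⟨hi.1, h⟩
            · exact Or.inr h
        _ ≤ phiFam 𝓕 τ (A ∩ Set.Iio m) + phiFam 𝓕 τ {m} := phiFam_union_le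
        _ ≤ c + δ := add_le_add h1
            (phiFam_le_mass.trans ((mass_singleton m).trans_le (hδ m hm)))
    · have hsub : A ∩ Set.Iio (m + 1) ⊆ A ∩ Set.Iio m := fun i hi =>
        ⟨hi.1, (Nat.lt_succ_iff_lt_or_eq.1 hi.2).resolve_right fun h => hm (h ▸ hi.1)⟩
      exact (phiFam_mono hsub).trans (h1.trans le_self_add)

end Phi

section Ideal

variable {𝓕 : Set (Set ℕ)} {τ : ℕ → ℝ} {A B : Set ℕ}

lemma mem_idealFam_iff :
    A ∈ idealFam 𝓕 τ ↔ ∀ ε > 0, ∃ n, phiFam 𝓕 τ (A \ Set.Iio n) ≤ ε := by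
  have hanti : Antitone fun n : ℕ => phiFam 𝓕 τ (A \ Set.Iio n) := fun m n hmn =>
    phiFam_mono (Set.sdiff_subset_sdiff_right (Set.Iio_subset_Iio hmn))
  refine (ENNReal.tendsto_atTop_zero (f := fun n : ℕ => phiFam 𝓕 τ (A \ Set.Iio n))).trans ?_
  exact ⟨fun h ε hε => let ⟨n, hn⟩ := h ε hε; ⟨n, hn n le_rfl⟩,
    fun h ε hε => let ⟨n, hn⟩ := h ε hε; ⟨n, fun m hm => (hanti hm).trans hn⟩⟩

lemma idealFam_mono (h : A ⊆ B) (hB : B ∈ idealFam 𝓕 τ) : A ∈ idealFam 𝓕 τ := by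
  rw [mem_idealFam_iff] at hB ⊢
  intro ε hε
  obtain ⟨n, hn⟩ := hB ε hε
  exact ⟨n, (phiFam_mono (Set.sdiff_subset_sdiff_left h)).trans hn⟩

lemma mem_idealFam_of_diff_Iio {n : ℕ} (h : A \ Set.Iio n ∈ idealFam 𝓕 τ) :
    A ∈ idealFam 𝓕 τ := by
  rw [mem_idealFam_iff] at h ⊢
  intro ε hε
  obtain ⟨m, hm⟩ := h ε hε
  refine ⟨max n m, (phiFam_mono ?_).trans hm⟩
  intro i hi
  have := hi.2
  simp only [Set.mem_Iio, lt_max_iff, not_or] at this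
  exact ⟨⟨hi.1, this.1⟩, this.2⟩

lemma finite_of_mem_idealFam (hcov : ∀ n : ℕ, ∃ F ∈ 𝓕, n ∈ F) (hA : A ∈ idealFam 𝓕 τ)
    {ε : ℝ≥0∞} (hε : 0 < ε) : (A ∩ {i | ε ≤ ENNReal.ofReal (τ i)}).Finite := by
  obtain ⟨c, hc0, hc⟩ := exists_between hε
  obtain ⟨n, hn⟩ := mem_idealFam_iff.1 hA c hc0
  refine (Set.finite_Iio n).subset fun i hi => ?_
  by_contra hin
  have hiA : i ∈ A \ Set.Iio n := ⟨hi.1, hin⟩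
  exact (hc.trans_le hi.2).not_ge ((ofReal_le_phiFam hcov hiA).trans hn)

end Ideal

section Nested

variable {s : ℕ → Set ℕ} {k : ℕ → ℕ}

lemma iUnion_inter_Iio_of_nested (hk : Monotone k)
    (hs : ∀ n, s (n + 1) ∩ Set.Iio (k n) = s n) (n : ℕ) :
    (⋃ m, s m) ∩ Set.Iio (k n) = s n := by
  have hmono : Monotone s := monotone_nat_of_le_succ fun n => by
    rw [← hs n]; exact Set.inter_subset_left
  have key : ∀ j, s (n + j) ∩ Set.Iio (k n) ⊆ s n := by
    intro j
    induction j with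
    | zero => exact Set.inter_subset_left
    | succ j ih =>
      intro i hi
      refine ih ⟨?_, hi.2⟩
      rw [← hs (n + j)]
      exact ⟨hi.1, lt_of_lt_of_le hi.2 (hk (Nat.le_add_right n j))⟩
  refine Set.Subset.antisymm ?_ fun i hi => ⟨Set.mem_iUnion.2 ⟨n, hi⟩, ?_⟩
  · rintro i ⟨hi, hin⟩
    obtain ⟨m, hm⟩ := Set.mem_iUnion.1 hi
    exact key m ⟨hmono (Nat.le_add_left m n) hm, hin⟩
  · rw [← hs n] at hi
    exact hi.2

end Nested

lemma chi_eq_iff {A B : Set ℕ} {i : ℕ} : chi A i = chi B i ↔ (i ∈ A ↔ i ∈ B) := by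
  simp [chi]

@[simp] lemma chi_apply_eq_true {A : Set ℕ} {i : ℕ} : chi A i = true ↔ i ∈ A := by
  simp [chi]

lemma chi_injective : Function.Injective chi := fun A B h => by
  ext i; exact chi_eq_iff.1 (congrFun h i)

lemma chi_eq_self (g : ℕ → Bool) : chi {n | g n = true} = g := by
  ext i; simp [chi]

lemma chi_mem_closure_iff {𝓕 : Set (Set ℕ)} {S : Set ℕ} :
    chi S ∈ closure (chi '' 𝓕) ↔ ∀ N, ∃ G ∈ 𝓕, G ∩ Set.Iio N = S ∩ Set.Iio N := by
  have hcyl : ∀ (G : Set ℕ) (N : ℕ), chi G ∈ PiNat.cylinder (chi S) N ↔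
      G ∩ Set.Iio N = S ∩ Set.Iio N := by
    intro G N
    simp only [PiNat.mem_cylinder_iff, chi_eq_iff, Set.ext_iff, Set.mem_inter_iff, Set.mem_Iio,
      and_congr_left_iff]
  constructor
  · intro h N
    obtain ⟨_, hx, G, hG, rfl⟩ := mem_closure_iff.1 h _
      (PiNat.isOpen_cylinder _ (chi S) N) (PiNat.self_mem_cylinder _ N)
    exact ⟨G, hG, (hcyl G N).1 hx⟩
  · intro h
    by_contra hS
    obtain ⟨N, hN⟩ := PiNat.exists_disjoint_cylinder isClosed_closure hS
    obtain ⟨G, hG, hGS⟩ := h N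
    exact Set.disjoint_left.1 hN (subset_closure ⟨G, hG, rfl⟩) ((hcyl G N).2 hGS)

/-- For an `F_σ` ideal `Exh φ` there is a radius such that all sets of smaller submeasure are in
the ideal. -/
lemma exists_radius_of_isFsigma {𝓕 : Set (Set ℕ)} {τ : ℕ → ℝ}
    (h : IsFsigma (chi '' idealFam 𝓕 τ)) :
    ∃ r : ℝ≥0∞, 0 < r ∧ ∀ D, phiFam 𝓕 τ D < r → D ∈ idealFam 𝓕 τ := by
  obtain ⟨C, hC, hCI⟩ := h
  by_contra! hr
  obtain ⟨ε, hε, hεsum⟩ := ENNReal.exists_pos_sum_of_countable' one_ne_zero ℕ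
  have step : ∀ (n : ℕ) (p : {p : Set ℕ × ℕ // p.1 ⊆ Set.Iio p.2}),
      ∃ q : {p : Set ℕ × ℕ // p.1 ⊆ Set.Iio p.2}, p.1.2 ≤ q.1.2 ∧
        q.1.1 ∩ Set.Iio p.1.2 = p.1.1 ∧ phiFam 𝓕 τ (q.1.1 \ Set.Iio p.1.2) ≤ ε n ∧
        ∀ A : Set ℕ, A ∩ Set.Iio q.1.2 = q.1.1 → chi A ∉ C n := by
    rintro n ⟨⟨s, k⟩, hsk⟩
    obtain ⟨D, hDε, hD⟩ := hr (ε n) (hε n)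
    have hmem : chi (s ∪ (D \ Set.Iio k)) ∉ C n := by
      intro hx
      have hx : chi (s ∪ (D \ Set.Iio k)) ∈ chi '' idealFam 𝓕 τ := by
        rw [hCI]; exact Set.mem_iUnion.2 ⟨n, hx⟩
      rw [chi_injective.mem_set_image] at hx
      exact hD (mem_idealFam_of_diff_Iio (idealFam_mono Set.subset_union_right hx))
    obtain ⟨N, hN⟩ := PiNat.exists_disjoint_cylinder (hC n) hmem
    refine ⟨⟨((s ∪ (D \ Set.Iio k)) ∩ Set.Iio (max k N), max k N), Set.inter_subset_right⟩,
      le_max_left _ _, ?_, ?_, ?_⟩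
    · ext i
      have := @hsk i
      simp only [Set.mem_inter_iff, Set.mem_union, Set.mem_sdiff, Set.mem_Iio, lt_max_iff] at this ⊢
      tauto
    · refine (phiFam_mono ?_).trans hDε.le
      intro i hi
      have := @hsk i
      simp only [Set.mem_inter_iff, Set.mem_union, Set.mem_sdiff, Set.mem_Iio, lt_max_iff]
        at this hi ⊢
      tauto
    · intro A hA hAC
      refine Set.disjoint_left.1 hN hAC ?_
      rw [PiNat.mem_cylinder_iff]
      intro i hi
      rw [chi_eq_iff]
      have := Set.ext_iff.1 hA i
      simp only [Set.mem_inter_iff, Set.mem_Iio, lt_max_iff, hi, or_true, and_true] at this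
      exact this
  choose f hf using step
  let p : ℕ → {p : Set ℕ × ℕ // p.1 ⊆ Set.Iio p.2} :=
    fun n => Nat.rec ⟨(∅, 0), Set.empty_subset _⟩ f n
  have hp : ∀ n, p (n + 1) = f n (p n) := fun _ => rfl
  have hk : Monotone fun n => (p n).1.2 := monotone_nat_of_le_succ fun n => by
    rw [hp]; exact (hf n (p n)).1
  have hinter := iUnion_inter_Iio_of_nested (s := fun n => (p n).1.1) hk
    (fun n => by rw [hp]; exact (hf n (p n)).2.1)
  set A : Set ℕ := ⋃ n, (p n).1.1
  have hmono : Monotone fun n => (p n).1.1 := fun m n hmn => by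
    have h1 := hinter m
    have h2 := hinter n
    simp only at h1 h2 ⊢
    rw [← h1, ← h2]
    exact Set.inter_subset_inter_right _ (Set.Iio_subset_Iio (hk hmn))
  have hA : A ∈ idealFam 𝓕 τ := by
    rw [mem_idealFam_iff]
    intro δ hδ
    have htail := ENNReal.tendsto_sum_nat_add ε (hεsum.trans ENNReal.one_lt_top).ne
    obtain ⟨n, hn⟩ := ((tendsto_order.1 htail).2 δ hδ).exists
    refine ⟨(p n).1.2, le_trans ?_ hn.le⟩
    calc phiFam 𝓕 τ (A \ Set.Iio (p n).1.2)
        ≤ phiFam 𝓕 τ (⋃ m, (p (m + n + 1)).1.1 \ Set.Iio (p (m + n)).1.2) := by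
          refine phiFam_mono ?_
          rintro i ⟨hi, hin⟩
          obtain ⟨m, hm⟩ := Set.mem_iUnion.1 hi
          have key : ∀ j, i ∈ (p (n + j)).1.1 →
              i ∈ ⋃ m, (p (m + n + 1)).1.1 \ Set.Iio (p (m + n)).1.2 := by
            intro j
            induction j with
            | zero => exact fun h => absurd ((p n).2 h) hin
            | succ j ih =>
              intro h
              by_cases hj : i < (p (n + j)).1.2
              · refine ih ?_
                exact (hinter (n + j)).subset ⟨hi, hj⟩
              · refine Set.mem_iUnion.2 ⟨j, ?_⟩
                rw [add_comm j n]
                exact ⟨h, hj⟩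
          exact key m (hmono (Nat.le_add_left m n) hm)
      _ ≤ ∑' m, phiFam 𝓕 τ ((p (m + n + 1)).1.1 \ Set.Iio (p (m + n)).1.2) := phiFam_iUnion_le _
      _ ≤ ∑' m, ε (m + n) := ENNReal.tsum_le_tsum fun m => by
          rw [hp]; exact (hf (m + n) (p (m + n))).2.2.1
  have hAC : chi A ∈ ⋃ n, C n := hCI ▸ Set.mem_image_of_mem chi hA
  obtain ⟨n, hn⟩ := Set.mem_iUnion.1 hAC
  exact (hf n (p n)).2.2.2 A (hinter (n + 1)) hn

section Blocks

variable {𝓕 : Set (Set ℕ)} {τ : ℕ → ℝ} {A B : Set ℕ}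

/-- The weights `τ i` tend to zero as `i → ∞` along `A`. -/
def WeightsVanish (τ : ℕ → ℝ) (A : Set ℕ) : Prop :=
  ∀ ε : ℝ≥0∞, 0 < ε → ∃ N, ∀ i ∈ A, N ≤ i → ENNReal.ofReal (τ i) ≤ ε

lemma WeightsVanish.mono (h : A ⊆ B) (hB : WeightsVanish τ B) : WeightsVanish τ A := fun ε hε =>
  let ⟨N, hN⟩ := hB ε hε
  ⟨N, fun i hi => hN i (h hi)⟩

/-- The set obtained by following `B (p k)` on the interval `[p k, p (k + 1))`. -/
def glue (B : ℕ → Set ℕ) (p : ℕ → ℕ) : Set ℕ := ⋃ k, B (p k) ∩ Set.Ico (p k) (p (k + 1))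

lemma exists_blocks (hfin : ∀ F ∈ 𝓕, F.Finite) {r c δ : ℝ≥0∞}
    (hr : ∀ D, phiFam 𝓕 τ D < r → D ∈ idealFam 𝓕 τ) (hcr : c < r) {B : ℕ → Set ℕ}
    (hB : ∀ p, B p ∉ idealFam 𝓕 τ) (hδ : ∀ p, ∀ i ∈ B p, ENNReal.ofReal (τ i) ≤ δ) (p₀ : ℕ) :
    ∃ p : ℕ → ℕ, StrictMono p ∧ p 0 = p₀ ∧ ∀ k,
      c < phiFam 𝓕 τ (B (p k) ∩ Set.Ico (p k) (p (k + 1))) ∧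
      phiFam 𝓕 τ (B (p k) ∩ Set.Ico (p k) (p (k + 1))) ≤ c + δ := by
  have step : ∀ p, ∃ q, p < q ∧ c < phiFam 𝓕 τ (B p ∩ Set.Ico p q) ∧
      phiFam 𝓕 τ (B p ∩ Set.Ico p q) ≤ c + δ := by
    intro p
    have hc : c < phiFam 𝓕 τ (B p \ Set.Iio p) := hcr.trans_le <| not_lt.1 fun h =>
      hB p (mem_idealFam_of_diff_Iio (hr _ h))
    obtain ⟨m, hm1, hm2⟩ := exists_phiFam_inter_Iio_mem_Ioc hfin (fun i hi => hδ p i hi.1) hc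
    have hset : B p \ Set.Iio p ∩ Set.Iio m = B p ∩ Set.Ico p m := by
      ext i; simp [and_assoc]
    rw [hset] at hm1 hm2
    refine ⟨m, ?_, hm1, hm2⟩
    by_contra hpm
    rw [Set.Ico_eq_empty hpm] at hm1
    simp [phiFam] at hm1
  choose f hf using step
  let p : ℕ → ℕ := fun k => Nat.rec p₀ (fun _ => f) k
  have hp : ∀ k, p (k + 1) = f (p k) := fun _ => rfl
  refine ⟨p, strictMono_nat_of_lt_succ fun k => ?_, rfl, fun k => ?_⟩
  · rw [hp]
    exact (hf (p k)).1
  · rw [hp]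
    exact (hf (p k)).2

lemma glue_notMem_idealFam {c : ℝ≥0∞} (hc : 0 < c) {B : ℕ → Set ℕ} {p : ℕ → ℕ}
    (hp : StrictMono p)
    (h : ∀ k, c < phiFam 𝓕 τ (B (p k) ∩ Set.Ico (p k) (p (k + 1)))) :
    glue B p ∉ idealFam 𝓕 τ := by
  intro hmem
  obtain ⟨n, hn⟩ := mem_idealFam_iff.1 hmem c hc
  refine (h n).not_ge ((phiFam_mono ?_).trans hn)
  intro i hi
  refine ⟨Set.mem_iUnion.2 ⟨n, hi⟩, ?_⟩
  exact not_lt.2 ((hp.le_apply (x := n)).trans hi.2.1)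

/-- `𝓖` is negligible if any set outside of the ideal along which the weights vanish can be thinned
out, without entering the ideal, so as to have small submeasure with respect to `𝓖`. -/
def Negligible (𝓕 : Set (Set ℕ)) (τ : ℕ → ℝ) (𝓖 : Set (Set ℕ)) : Prop :=
  ∀ A, A ∉ idealFam 𝓕 τ → WeightsVanish τ A → ∀ ε : ℝ≥0∞, 0 < ε →
    ∃ D ⊆ A, D ∉ idealFam 𝓕 τ ∧ phiFam 𝓖 τ D ≤ ε

/-- The members of `𝓕` whose trace on `[0, n)` is `s`. -/
def startingWith (𝓕 : Set (Set ℕ)) (s : Set ℕ) (n : ℕ) : Set (Set ℕ) :=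
  {G ∈ 𝓕 | G ∩ Set.Iio n = s}

/-- A set of members of `𝓕` with a common trace on `[0, n)` is negligible as soon as all its parts determined
by the next element are. -/
lemma negligible_startingWith (hfin : ∀ F ∈ 𝓕, F.Finite) {r : ℝ≥0∞} (hr0 : 0 < r)
    (hr : ∀ D, phiFam 𝓕 τ D < r → D ∈ idealFam 𝓕 τ) {s : Set ℕ} {n : ℕ}
    (h : ∀ j, n ≤ j → Negligible 𝓕 τ (startingWith 𝓕 (insert j s) (j + 1))) :
    Negligible 𝓕 τ (startingWith 𝓕 s n) := by
  intro A hA hAτ ε hε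
  have hε4 : 0 < ε / 4 := ENNReal.div_pos hε.ne' (by simp)
  obtain ⟨c, hc0, hc⟩ := exists_between (lt_min hε4 hr0)
  obtain ⟨N, hN⟩ := hAτ (ε / 4) hε4
  have step : ∀ (j : ℕ) (D : {D : Set ℕ // D ⊆ A ∧ D ∉ idealFam 𝓕 τ}),
      ∃ D' : {D : Set ℕ // D ⊆ A ∧ D ∉ idealFam 𝓕 τ}, D'.1 ⊆ D.1 ∧
        (n ≤ j → phiFam (startingWith 𝓕 (insert j s) (j + 1)) τ D'.1 ≤ ε / 2) := by
    rintro j ⟨D, hDA, hD⟩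
    by_cases hj : n ≤ j
    · obtain ⟨D', hD'D, hD', hle⟩ := h j hj D hD (hAτ.mono hDA) (ε / 2) (ENNReal.half_pos hε.ne')
      exact ⟨⟨D', hD'D.trans hDA, hD'⟩, hD'D, fun _ => hle⟩
    · exact ⟨⟨D, hDA, hD⟩, subset_rfl, fun h => absurd h hj⟩
  choose f hf using step
  let D : ℕ → {D : Set ℕ // D ⊆ A ∧ D ∉ idealFam 𝓕 τ} := fun j => Nat.rec ⟨A, subset_rfl, hA⟩ f j
  have hD : ∀ j, D (j + 1) = f j (D j) := fun _ => rfl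
  have hanti : Antitone fun j => (D j).1 := antitone_nat_of_succ_le fun j => by
    rw [hD]; exact (hf j (D j)).1
  obtain ⟨p, hp, hp0, hpk⟩ := exists_blocks (B := fun j => (D j).1 \ Set.Iio N) hfin hr
    (hc.trans_le (min_le_right _ _)) (fun j hj => (D j).2.2 (mem_idealFam_of_diff_Iio hj))
    (δ := ε / 4) (fun j i hi => hN i ((D j).2.1 hi.1) (not_lt.1 hi.2)) n
  refine ⟨glue (fun j => (D j).1 \ Set.Iio N) p, ?_, glue_notMem_idealFam hc0 hp fun k => (hpk k).1,
    ?_⟩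
  · exact Set.iUnion_subset fun k i hi => (D (p k)).2.1 hi.1.1
  refine phiFam_le_iff.2 fun G hG => ?_
  have hge : ∀ i ∈ glue (fun j => (D j).1 \ Set.Iio N) p, n ≤ i := fun i hi => by
    obtain ⟨k, hk⟩ := Set.mem_iUnion.1 hi
    exact (hp0 ▸ hp.monotone (Nat.zero_le k)).trans hk.2.1
  by_cases hex : ∃ j, n ≤ j ∧ j ∈ G
  · classical
    obtain ⟨hnj, hjG⟩ := Nat.find_spec hex
    have hmin : ∀ i ∈ G, n ≤ i → Nat.find hex ≤ i := fun i hi hni => Nat.find_min' hex ⟨hni, hi⟩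
    generalize Nat.find hex = j at hnj hjG hmin
    have hGj : G ∈ startingWith 𝓕 (insert j s) (j + 1) := by
      refine ⟨hG.1, ?_⟩
      rw [← hG.2]
      ext i
      simp only [Set.mem_inter_iff, Set.mem_insert_iff, Set.mem_Iio, Nat.lt_succ_iff]
      constructor
      · rintro ⟨hi, hij⟩
        by_cases hin : i < n
        · exact Or.inr ⟨hi, hin⟩
        · exact Or.inl (le_antisymm hij (hmin i hi (not_lt.1 hin)))
      · rintro (rfl | ⟨hi, hin⟩)
        · exact ⟨hjG, le_rfl⟩
        · exact ⟨hi, hin.le.trans hnj⟩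
    have hlate : phiFam (startingWith 𝓕 (insert j s) (j + 1)) τ (D (j + 1)).1 ≤ ε / 2 := by
      rw [hD]; exact (hf j (D j)).2 hnj
    obtain ⟨k, hk⟩ : ∃ k, ∀ l, p l ≤ j → j < p (l + 1) → l = k := by
      by_cases hk : ∃ k, p k ≤ j ∧ j < p (k + 1)
      · obtain ⟨k, hk1, hk2⟩ := hk
        refine ⟨k, fun l hl1 hl2 => ?_⟩
        have h1 := hp.lt_iff_lt.1 (hl1.trans_lt hk2)
        have h2 := hp.lt_iff_lt.1 (hk1.trans_lt hl2)
        omega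
      · exact ⟨0, fun l hl1 hl2 => absurd ⟨l, hl1, hl2⟩ hk⟩
    calc mass τ (G ∩ glue (fun j => (D j).1 \ Set.Iio N) p)
        ≤ mass τ ((G ∩ (((D (p k)).1 \ Set.Iio N) ∩ Set.Ico (p k) (p (k + 1)))) ∪
            (G ∩ (D (j + 1)).1)) := by
          refine mass_mono ?_
          rintro i ⟨hiG, hi⟩
          have hji := hmin i hiG (hge i hi)
          obtain ⟨l, hl⟩ := Set.mem_iUnion.1 hi
          by_cases hlj : p l ≤ j
          · obtain rfl := hk l hlj (hji.trans_lt hl.2.2)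
            exact Or.inl ⟨hiG, hl⟩
          · exact Or.inr ⟨hiG, hanti (Nat.succ_le_of_lt (not_le.1 hlj)) hl.1.1⟩
      _ ≤ _ := mass_union_le
      _ ≤ ε / 2 + ε / 2 := by
          refine add_le_add ?_ ((mass_inter_le_phiFam hGj).trans hlate)
          refine ((mass_inter_le_phiFam hG.1).trans (hpk k).2).trans ?_
          calc c + ε / 4 ≤ ε / 4 + ε / 4 := by gcongr; exact (hc.trans_le (min_le_left _ _)).le
            _ = ε / 2 := by
              rw [← two_mul, ENNReal.div_eq_inv_mul, ENNReal.div_eq_inv_mul, ← mul_assoc]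
              congr 1
              rw [show (4 : ℝ≥0∞) = 2 * 2 by norm_num, ENNReal.mul_inv (by simp) (by simp),
                ← mul_assoc, ENNReal.mul_inv_cancel (by simp) (by simp), one_mul]
      _ = ε := ENNReal.add_halves ε
  · have : G ∩ glue (fun j => (D j).1 \ Set.Iio N) p = ∅ :=
      Set.eq_empty_of_forall_notMem fun i hi => hex ⟨i, hge i hi.2, hi.1⟩
    simp [this]

lemma Precompact.negligible (hpre : Precompact 𝓕) (hfin : ∀ F ∈ 𝓕, F.Finite) {r : ℝ≥0∞}
    (hr0 : 0 < r) (hr : ∀ D, phiFam 𝓕 τ D < r → D ∈ idealFam 𝓕 τ) : Negligible 𝓕 τ 𝓕 := by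
  by_contra hbad
  let T := {q : Set ℕ × ℕ // q.1 ⊆ Set.Iio q.2 ∧ ¬ Negligible 𝓕 τ (startingWith 𝓕 q.1 q.2)}
  have hbad0 : ¬ Negligible 𝓕 τ (startingWith 𝓕 ∅ 0) := by
    have : startingWith 𝓕 ∅ 0 = 𝓕 := by ext G; simp [startingWith]
    rwa [this]
  have step : ∀ q : T, ∃ q' : T, ∃ j, q.1.2 ≤ j ∧ q'.1 = (insert j q.1.1, j + 1) := by
    rintro ⟨⟨s, n⟩, hs, hq⟩
    by_contra! hno
    refine hq (negligible_startingWith hfin hr0 hr fun j hj => ?_)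
    by_contra hneg
    refine hno ⟨(insert j s, j + 1), ?_, hneg⟩ j hj rfl
    exact Set.insert_subset (Nat.lt_succ_self j)
      (hs.trans (Set.Iio_subset_Iio (hj.trans (Nat.le_succ j))))
  choose f m hm hf using step
  let q : ℕ → T := fun k => Nat.rec ⟨(∅, 0), Set.empty_subset _, hbad0⟩ (fun _ => f) k
  have hq : ∀ k, (q (k + 1)).1 = (insert (m (q k)) (q k).1.1, m (q k) + 1) := fun k => hf (q k)
  have hlt : StrictMono fun k => (q k).1.2 := strictMono_nat_of_lt_succ fun k => by
    rw [hq]; exact Nat.lt_succ_of_le (hm (q k))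
  have hinter := iUnion_inter_Iio_of_nested (s := fun k => (q k).1.1) hlt.monotone fun k => by
    rw [hq]
    ext i
    have h1 := @(q k).2.1 i
    have h2 := hm (q k)
    simp only [Set.mem_inter_iff, Set.mem_insert_iff, Set.mem_Iio] at h1 ⊢
    constructor
    · rintro ⟨rfl | h, h'⟩
      · omega
      · exact h
    · exact fun h => ⟨Or.inr h, h1 h⟩
  have hclosure : chi (⋃ k, (q k).1.1) ∈ closure (chi '' 𝓕) := by
    rw [chi_mem_closure_iff]
    intro N
    obtain ⟨G, hG⟩ : (startingWith 𝓕 (q N).1.1 (q N).1.2).Nonempty := by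
      by_contra hempty
      rw [Set.not_nonempty_iff_eq_empty] at hempty
      refine (q N).2.2 fun A hA _ ε _ => ⟨A, subset_rfl, hA, ?_⟩
      rw [hempty]
      simp [phiFam]
    refine ⟨G, hG.1, ?_⟩
    have h1 : G ∩ Set.Iio (q N).1.2 = (⋃ k, (q k).1.1) ∩ Set.Iio (q N).1.2 :=
      hG.2.trans (hinter N).symm
    have hN : Set.Iio N = Set.Iio (q N).1.2 ∩ Set.Iio N :=
      (Set.inter_eq_right.2 (Set.Iio_subset_Iio (hlt.le_apply (x := N)))).symm
    rw [hN, ← Set.inter_assoc, ← Set.inter_assoc, h1]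
  have hfinite := hpre _ hclosure
  simp only [chi_apply_eq_true] at hfinite
  obtain ⟨M, hM⟩ := hfinite.bddAbove
  have h1 : m (q (M + 1)) ∈ ⋃ k, (q k).1.1 :=
    Set.mem_iUnion.2 ⟨M + 1 + 1, by rw [hq (M + 1)]; exact Set.mem_insert _ _⟩
  have h2 := hM h1
  have h3 := hm (q (M + 1))
  have h4 : M + 1 ≤ (q (M + 1)).1.2 := hlt.le_apply (x := M + 1)
  omega

theorem Precompact.exists_eq_of_isFsigma (hpre : Precompact 𝓕) (hfin : ∀ F ∈ 𝓕, F.Finite)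
    (hcov : ∀ n : ℕ, ∃ F ∈ 𝓕, n ∈ F) (h : IsFsigma (chi '' idealFam 𝓕 τ)) :
    ∃ X : Set ℕ, idealFam 𝓕 τ = {A : Set ℕ | (A ∩ X).Finite} := by
  obtain ⟨r, hr0, hr⟩ := exists_radius_of_isFsigma h
  obtain ⟨c, hc0, hcr⟩ := exists_between hr0
  by_cases hsmall : ∃ ε : ℝ≥0∞, 0 < ε ∧ {i | ENNReal.ofReal (τ i) < ε} ∈ idealFam 𝓕 τ
  · obtain ⟨ε, hε, hmem⟩ := hsmall
    refine ⟨{i | ε ≤ ENNReal.ofReal (τ i)}, Set.Subset.antisymm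
      (fun A hA => finite_of_mem_idealFam hcov hA hε) fun A hA => ?_⟩
    obtain ⟨n, hn⟩ := Set.Finite.bddAbove hA
    refine mem_idealFam_of_diff_Iio (n := n + 1) (idealFam_mono (fun i hi => ?_) hmem)
    refine not_le.1 fun hle : ε ≤ ENNReal.ofReal (τ i) => hi.2 (Nat.lt_succ_of_le (hn ⟨hi.1, hle⟩))
  · exfalso
    push Not at hsmall
    obtain ⟨p, hp, -, hpk⟩ := exists_blocks hfin hr hcr (δ := ⊤)
      (B := fun p => {i | ENNReal.ofReal (τ i) < (p + 1 : ℝ≥0∞)⁻¹})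
      (fun p => hsmall _ (ENNReal.inv_pos.2 (by finiteness))) (fun _ _ _ => le_top) 0
    set A := glue (fun p => {i | ENNReal.ofReal (τ i) < (p + 1 : ℝ≥0∞)⁻¹}) p
    have hA : A ∉ idealFam 𝓕 τ := glue_notMem_idealFam hc0 hp fun k => (hpk k).1
    have hAτ : WeightsVanish τ A := by
      intro ε hε
      obtain ⟨n, hn⟩ := ENNReal.exists_inv_nat_lt hε.ne'
      refine ⟨p n, fun i hi hni => ?_⟩
      obtain ⟨k, hk1, hk2⟩ := Set.mem_iUnion.1 hi
      have hnk : n < k + 1 := hp.lt_iff_lt.1 (hni.trans_lt hk2.2)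
      refine (hk1.le.trans ?_).trans hn.le
      refine ENNReal.inv_le_inv.2 ?_
      have h1 : n ≤ p k + 1 := (Nat.lt_succ_iff.1 hnk).trans
        ((hp.le_apply (x := k)).trans (Nat.le_succ _))
      exact_mod_cast h1
    obtain ⟨D, -, hD, hle⟩ := hpre.negligible hfin hr0 hr A hA hAτ c hc0
    exact hD (hr D (hle.trans_lt hcr))

end Blocks

section Summable

variable {τ : ℕ → ℝ}

lemma isFsigma_mass_ne_top (τ : ℕ → ℝ) : IsFsigma (chi '' {A | mass τ A ≠ ⊤}) := by
  let S : ℕ → (ℕ → Bool) → ℝ≥0∞ := fun N x =>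
    ∑ i ∈ Finset.range N, if x i = true then ENNReal.ofReal (τ i) else 0
  have hcont : ∀ N, Continuous (S N) := fun N => continuous_finsetSum _ fun i _ =>
    (continuous_of_discreteTopology (f := fun b : Bool =>
      if b = true then ENNReal.ofReal (τ i) else 0)).comp (continuous_apply i)
  have hS : ∀ A : Set ℕ, mass τ A = ⨆ N, S N (chi A) := fun A => by
    classical
    simp only [mass_eq_iSup, S, chi_apply_eq_true, Set.indicator_apply]
  refine ⟨fun n => ⋂ N, {x | S N x ≤ n}, fun n => isClosed_iInter fun N =>
    isClosed_le (hcont N) continuous_const, ?_⟩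
  ext x
  rw [← chi_eq_self x, chi_injective.mem_set_image]
  simp only [Set.mem_iUnion, Set.mem_iInter, Set.mem_ofPred_eq, hS, ← iSup_le_iff]
  constructor
  · intro h
    obtain ⟨n, hn⟩ := ENNReal.exists_nat_gt h
    exact ⟨n, hn.le⟩
  · rintro ⟨n, hn⟩
    exact ne_top_of_le_ne_top (ENNReal.natCast_ne_top n) hn

/-- If `B` is in the closure of the family and the weights are at least `1` off
`B`, then the ideal is the summable ideal of `τ`. -/
lemma idealFam_eq_mass_ne_top {𝓕 : Set (Set ℕ)} (hcov : ∀ n : ℕ, ∃ F ∈ 𝓕, n ∈ F) {B : Set ℕ}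
    (hB : chi B ∈ closure (chi '' 𝓕)) (hτ : ∀ i ∉ B, 1 ≤ τ i) :
    idealFam 𝓕 τ = {A | mass τ A ≠ ⊤} := by
  have hmass : ∀ A, mass τ (B ∩ A) ≤ phiFam 𝓕 τ A := fun A => by
    rw [mass_eq_iSup]
    refine iSup_le fun N => ?_
    obtain ⟨G, hG, hGB⟩ := chi_mem_closure_iff.1 hB N
    refine le_trans ?_ (mass_inter_le_phiFam hG)
    rw [mass_eq_iSup]
    refine le_trans (Finset.sum_le_sum fun i hi => ?_)
      (le_iSup (fun n => ∑ i ∈ Finset.range n,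
        (G ∩ A).indicator (fun i => ENNReal.ofReal (τ i)) i) N)
    have hiff : i ∈ G ↔ i ∈ B := by
      have := Set.ext_iff.1 hGB i
      simpa only [Set.mem_inter_iff, Set.mem_Iio, Finset.mem_range.1 hi, and_true] using this
    classical
    simp only [Set.indicator_apply, Set.mem_inter_iff, hiff, le_refl]
  ext A
  constructor
  · intro hA
    obtain ⟨c, hc0, hc1⟩ := exists_between (zero_lt_one (α := ℝ≥0∞))
    obtain ⟨n, hn⟩ := mem_idealFam_iff.1 hA c hc0
    have hsub : A \ Set.Iio n ⊆ B := fun i hi => by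
      by_contra hiB
      refine (hc1.trans_le ?_).not_ge ((ofReal_le_phiFam hcov hi).trans hn)
      exact ENNReal.one_le_ofReal.2 (hτ i hiB)
    have h1 : mass τ (A \ Set.Iio n) ≤ c := by
      have := (hmass (A \ Set.Iio n)).trans hn
      rwa [Set.inter_eq_right.2 hsub] at this
    have h2 : mass τ A ≤ mass τ (Set.Iio n) + mass τ (A \ Set.Iio n) :=
      (mass_mono fun i hi => by
        by_cases h : i < n
        · exact Or.inl h
        · exact Or.inr ⟨hi, h⟩).trans mass_union_le
    exact ne_top_of_le_ne_top (ENNReal.add_ne_top.2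
      ⟨mass_Iio_ne_top n, (h1.trans_lt (hc1.trans ENNReal.one_lt_top)).ne⟩) h2
  · intro hA
    exact tendsto_of_tendsto_of_tendsto_of_le_of_le tendsto_const_nhds (tendsto_mass_diff_Iio hA)
      (fun _ => zero_le) fun _ => phiFam_le_mass

open Classical in
/-- The weights `1 / (k + 1)` on the `k`-th element of `B`, and `1` off `B`. -/
noncomputable def harmonicWeight (B : Set ℕ) (i : ℕ) : ℝ :=
  if i ∈ B then 1 / ((Nat.count (· ∈ B) i : ℝ) + 1) else 1

lemma harmonicWeight_pos (B : Set ℕ) (i : ℕ) : 0 < harmonicWeight B i := by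
  unfold harmonicWeight
  split_ifs <;> positivity

lemma harmonicWeight_nth {B : Set ℕ} (hB : B.Infinite) (k : ℕ) :
    harmonicWeight B (Nat.nth (· ∈ B) k) = 1 / ((k : ℝ) + 1) := by
  classical
  have hB' : (Set.ofPred (· ∈ B)).Infinite := hB
  rw [harmonicWeight, if_pos (Nat.nth_mem_of_infinite hB' k), Nat.count_nth_of_infinite hB']

lemma mass_harmonicWeight {B : Set ℕ} (hB : B.Infinite) : mass (harmonicWeight B) B = ⊤ := by
  have hB' : (Set.ofPred (· ∈ B)).Infinite := hB
  have hrange : Set.range (Nat.nth (· ∈ B)) = B := Nat.range_nth_of_infinite hB'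
  have h := mass_range (τ := harmonicWeight B) (Nat.nth_injective hB')
  rw [hrange] at h
  rw [h]
  by_contra hne
  have hs := ENNReal.summable_toReal hne
  simp only [harmonicWeight_nth hB] at hs
  refine Real.not_summable_one_div_natCast ((summable_nat_add_iff 1).1 (hs.congr fun k => ?_))
  rw [ENNReal.toReal_ofReal (by positivity)]
  push_cast
  rfl

lemma exists_infinite_subset_mass_ne_top {B Y : Set ℕ} (hYB : Y ⊆ B) (hY : Y.Infinite) :
    ∃ A ⊆ Y, A.Infinite ∧ mass (harmonicWeight B) A ≠ ⊤ := by
  classical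
  obtain ⟨ε, hε, hεsum⟩ := ENNReal.exists_pos_sum_of_countable' one_ne_zero ℕ
  have hB : (Set.ofPred (· ∈ B)).Infinite := hY.mono hYB
  have hsmall : ∀ δ : ℝ≥0∞, 0 < δ →
      ∀ᶠ i in atTop, i ∈ B → ENNReal.ofReal (harmonicWeight B i) ≤ δ := by
    intro δ hδ
    have hlim : Tendsto (fun k : ℕ => ENNReal.ofReal (1 / ((k : ℝ) + 1))) atTop (𝓝 0) := by
      simpa using ENNReal.tendsto_ofReal (tendsto_one_div_add_atTop_nhds_zero_nat (𝕜 := ℝ))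
    obtain ⟨K, hK⟩ := (ENNReal.tendsto_atTop_zero.1 hlim) δ hδ
    filter_upwards [eventually_ge_atTop (Nat.nth (· ∈ B) K)] with i hi hiB
    rw [harmonicWeight, if_pos hiB]
    refine hK _ ?_
    rw [← Nat.count_nth_of_infinite hB K]
    exact Nat.count_monotone _ hi
  obtain ⟨a, ha, haY⟩ := extraction_forall_of_frequently
    (P := fun k i => i ∈ Y ∧ ENNReal.ofReal (harmonicWeight B i) ≤ ε k) fun k =>
      ((Nat.frequently_atTop_iff_infinite.2 hY).and_eventually (hsmall _ (hε k))).mono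
        fun i hi => ⟨hi.1, hi.2 (hYB hi.1)⟩
  refine ⟨Set.range a, Set.range_subset_iff.2 fun k => (haY k).1,
    Set.infinite_range_of_injective ha.injective, ?_⟩
  rw [mass_range ha.injective]
  exact ((ENNReal.tsum_le_tsum fun k => (haY k).2).trans_lt
    (hεsum.trans ENNReal.one_lt_top)).ne

end Summable

theorem stmt8 (𝓕 : Set (Set ℕ))
    (hfin : ∀ F ∈ 𝓕, F.Finite) (hcov : ∀ n : ℕ, ∃ F ∈ 𝓕, n ∈ F) :
    Precompact 𝓕 ↔
      ∀ τ : ℕ → ℝ, (∀ n, 0 < τ n) → IsFsigma (chi '' idealFam 𝓕 τ) →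
        ∃ X : Set ℕ, idealFam 𝓕 τ = {A : Set ℕ | (A ∩ X).Finite} := by
  refine ⟨fun hpre τ _ h => hpre.exists_eq_of_isFsigma hfin hcov h, fun h => ?_⟩
  intro g hg
  by_contra hinf
  set B : Set ℕ := {n | g n = true} with hBdef
  have hB : B.Infinite := hinf
  have hI : idealFam 𝓕 (harmonicWeight B) = {A | mass (harmonicWeight B) A ≠ ⊤} := by
    refine idealFam_eq_mass_ne_top hcov (B := B) ?_ fun i hi => ?_
    · rwa [hBdef, chi_eq_self]
    · rw [harmonicWeight, if_neg hi]
  obtain ⟨X, hX⟩ := h (harmonicWeight B) (harmonicWeight_pos B)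
    (by rw [hI]; exact isFsigma_mass_ne_top _)
  rw [hI] at hX
  by_cases hBX : (B ∩ X).Finite
  · exact hX.symm.subset hBX (mass_harmonicWeight hB)
  · obtain ⟨A, hA, hAinf, hAmass⟩ := exists_infinite_subset_mass_ne_top Set.inter_subset_left hBX
    have hAX : (A ∩ X).Finite := hX.subset hAmass
    rw [Set.inter_eq_left.2 (hA.trans Set.inter_subset_right)] at hAX
    exact hAinf hAX
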